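/- arXiv:1809.01525 — 3 statements merged into one kernel-verified Lean document; each statement's English description precedes it below -/
import Mathlib

section
/- Let k ≥ 2 be an integer and let 𝒰_k = {U₁, U₂} with U₁ = {(0,−1),(k,0),(k−1,0)} and U₂ = {(0,−1),(−k,0),(−k+1,0)}. Let u = (0,1), let p : ℤ² → ℤ² be the projection p(i,j) = (i,0), and for Y ⊆ ℤ²∖H_u write Ȳ = [H_u ∪ Y]∖H_u. Then for every finite Z ⊆ ℤ²∖H_u one has p(Z̄) ⊆ \overline{p(Z)}, i.e., the projection of the closure of Z is contained in the closure of the projection of Z. -/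
open scoped Classical

/-- A site of the two-dimensional lattice. -/
abbrev Site : Type := ℤ × ℤ

/-- An update family: a finite nonempty collection of finite nonempty rules,
none containing the origin. We represent the collection as a `Finset (Finset Site)`
together with this well-formedness predicate. -/
def IsUpdateFamily (𝒰 : Finset (Finset Site)) : Prop :=
  𝒰.Nonempty ∧ ∀ U ∈ 𝒰, U.Nonempty ∧ ((0, 0) : Site) ∉ U

/-- One step of the bootstrap percolation dynamics. -/
def bpStep (𝒰 : Finset (Finset Site)) (A : Set Site) : Set Site :=
  A ∪ {x : Site | ∃ U ∈ 𝒰, ∀ y ∈ U, x + y ∈ A}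

/-- The configuration after `t` steps of the dynamics started from `A`. -/
def bpIter (𝒰 : Finset (Finset Site)) (A : Set Site) : ℕ → Set Site
  | 0 => A
  | n + 1 => bpStep 𝒰 (bpIter 𝒰 A n)

/-- The closure `[A]` of a set `A` under the bootstrap dynamics. -/
def bpClosure (𝒰 : Finset (Finset Site)) (A : Set Site) : Set Site :=
  ⋃ n : ℕ, bpIter 𝒰 A n

/-- The unit circle `S¹ ⊆ ℝ²`. -/
def sphere2 : Set (ℝ × ℝ) := {u : ℝ × ℝ | u.1 ^ 2 + u.2 ^ 2 = 1}

/-- Inner product of a lattice site with a real vector. -/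
def inner2 (x : Site) (u : ℝ × ℝ) : ℝ := (x.1 : ℝ) * u.1 + (x.2 : ℝ) * u.2

/-- The open half-plane `H_u` with outer normal `u`. -/
def halfPlane (u : ℝ × ℝ) : Set Site := {x : Site | inner2 x u < 0}

/-- The lattice line `l_u` through the origin perpendicular to `u`. -/
def lineu (u : ℝ × ℝ) : Set Site := {x : Site | inner2 x u = 0}

/-- A direction `u` is unstable if some rule lies in `H_u`. -/
def Unstable (𝒰 : Finset (Finset Site)) (u : ℝ × ℝ) : Prop :=
  ∃ U ∈ 𝒰, (U : Set Site) ⊆ halfPlane u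

/-- A direction of the unit circle is stable if it is not unstable. -/
def Stable (𝒰 : Finset (Finset Site)) (u : ℝ × ℝ) : Prop :=
  u ∈ sphere2 ∧ ¬ Unstable 𝒰 u

/-- The set of stable directions. -/
def stableSet (𝒰 : Finset (Finset Site)) : Set (ℝ × ℝ) := {u | Stable 𝒰 u}

/-- An isolated stable direction: a stable direction not in the (topological)
closure of the set of other stable directions. -/
def IsolatedStable (𝒰 : Finset (Finset Site)) (u : ℝ × ℝ) : Prop :=
  Stable 𝒰 u ∧ u ∉ closure (stableSet 𝒰 \ {u})

/-- The open semicircle of the unit circle centred at the direction `v`. -/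
def openSemicircle (v : ℝ × ℝ) : Set (ℝ × ℝ) :=
  {u ∈ sphere2 | 0 < u.1 * v.1 + u.2 * v.2}

/-- A family is supercritical if some open semicircle consists of unstable directions. -/
def Supercritical (𝒰 : Finset (Finset Site)) : Prop :=
  ∃ v ∈ sphere2, ∀ u ∈ openSemicircle v, Unstable 𝒰 u

/-- A family is critical if it is not supercritical and some open semicircle
contains only finitely many stable directions. -/
def Critical (𝒰 : Finset (Finset Site)) : Prop :=
  ¬ Supercritical 𝒰 ∧ ∃ v ∈ sphere2, (stableSet 𝒰 ∩ openSemicircle v).Finite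

/-- The difficulty `α(u)` of a direction: `0` for unstable directions, `∞` for
non-isolated stable directions, and for isolated stable directions the minimum
cardinality of a finite `Z ⊆ ℤ² ∖ H_u` such that `[H_u ∪ Z] ∖ H_u` is infinite. -/
noncomputable def dirDifficulty (𝒰 : Finset (Finset Site)) (u : ℝ × ℝ) : ℕ∞ :=
  if Unstable 𝒰 u then 0
  else if IsolatedStable 𝒰 u then
    sInf {n : ℕ∞ | ∃ Z : Finset Site, (∀ z ∈ Z, z ∉ halfPlane u) ∧
      (bpClosure 𝒰 (halfPlane u ∪ (Z : Set Site)) \ halfPlane u).Infinite ∧ n = Z.card}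
  else ⊤

/-- The difficulty `α(𝒰)` of an update family. -/
noncomputable def difficulty (𝒰 : Finset (Finset Site)) : ℕ∞ :=
  ⨅ v ∈ sphere2, ⨆ u ∈ openSemicircle v, dirDifficulty 𝒰 u

/-- The diameter `D` of an update family: `2 · max{‖x‖_∞ : x ∈ ⋃ U ∈ 𝒰, U}`. -/
def famDiam (𝒰 : Finset (Finset Site)) : ℕ :=
  2 * 𝒰.sup (fun U => U.sup (fun x => max x.1.natAbs x.2.natAbs))

/-- The update family `𝒰_k = {U₁, U₂}` with `U₁ = {(0,−1),(k,0),(k−1,0)}` and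
`U₂ = {(0,−1),(−k,0),(−k+1,0)}`. -/
def famUk (k : ℕ) : Finset (Finset Site) :=
  { ({((0 : ℤ), (-1 : ℤ)), ((k : ℤ), (0 : ℤ)), ((k : ℤ) - 1, (0 : ℤ))} : Finset Site),
    ({((0 : ℤ), (-1 : ℤ)), (-(k : ℤ), (0 : ℤ)), (-(k : ℤ) + 1, (0 : ℤ))} : Finset Site) }

theorem mem_halfPlane_up (x : Site) : x ∈ halfPlane ((0 : ℝ), (1 : ℝ)) ↔ x.2 < 0 := by
  simp [halfPlane, inner2]

theorem subset_bpIter (𝒰 : Finset (Finset Site)) (A : Set Site) (n : ℕ) :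
    A ⊆ bpIter 𝒰 A n := by
  induction n with
  | zero => exact subset_rfl
  | succ n ih => exact ih.trans Set.subset_union_left

theorem snd_nonpos_of_mem_famUk {k : ℕ} {U : Finset Site} (hU : U ∈ famUk k) {y : Site}
    (hy : y ∈ U) : y.2 ≤ 0 := by
  simp only [famUk, Finset.mem_insert, Finset.mem_singleton] at hU
  rcases hU with rfl | rfl <;> simp only [Finset.mem_insert, Finset.mem_singleton] at hy <;>
    rcases hy with rfl | rfl | rfl <;> simp

/-- If all rules lie in the closed lower half-plane, then projecting a configuration onto the
horizontal axis does not slow down the infection of projected sites. -/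
theorem proj_mem_bpIter {𝒰 : Finset (Finset Site)} (h𝒰 : ∀ U ∈ 𝒰, ∀ y ∈ U, y.2 ≤ 0)
    (Z : Set Site) (n : ℕ) (x : Site)
    (hx : x ∈ bpIter 𝒰 (halfPlane ((0 : ℝ), (1 : ℝ)) ∪ Z) n) (hx0 : 0 ≤ x.2) :
    (x.1, (0 : ℤ)) ∈ bpIter 𝒰
      (halfPlane ((0 : ℝ), (1 : ℝ)) ∪ (fun x : Site => (x.1, (0 : ℤ))) '' Z) n := by
  induction n generalizing x with
  | zero =>
    rcases hx with hx | hx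
    · exact absurd ((mem_halfPlane_up x).1 hx) hx0.not_gt
    · exact Or.inr ⟨x, hx, rfl⟩
  | succ n ih =>
    rcases hx with hx | ⟨U, hU, hUx⟩
    · exact Or.inl (ih x hx hx0)
    · refine Or.inr ⟨U, hU, fun y hy => ?_⟩
      rcases (h𝒰 U hU y hy).lt_or_eq with h | h
      · refine subset_bpIter _ _ n (Or.inl ((mem_halfPlane_up _).2 ?_))
        simpa using h
      · simpa [Prod.add_def, h] using ih (x + y) (hUx y hy) (by simpa [h] using hx0)

/-- for the family `𝒰_k` (`k ≥ 2`), `u = (0,1)` and the projection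
`p(i,j) = (i,0)` onto `l_u`, for every finite `Z ⊆ ℤ² ∖ H_u` the projection of
`Z̄ = [H_u ∪ Z] ∖ H_u` is contained in the closure `\overline{p(Z)}` of the
projection of `Z`. -/
theorem famUk_projection (k : ℕ) (hk : 2 ≤ k) (Z : Finset Site)
    (hZ : ∀ z ∈ Z, z ∉ halfPlane ((0 : ℝ), (1 : ℝ))) :
    (fun x : Site => (x.1, (0 : ℤ))) ''
        (bpClosure (famUk k) (halfPlane ((0 : ℝ), (1 : ℝ)) ∪ (Z : Set Site))
          \ halfPlane ((0 : ℝ), (1 : ℝ))) ⊆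
      bpClosure (famUk k)
          (halfPlane ((0 : ℝ), (1 : ℝ)) ∪ (fun x : Site => (x.1, (0 : ℤ))) '' (Z : Set Site))
        \ halfPlane ((0 : ℝ), (1 : ℝ)) := by
  rintro _ ⟨x, ⟨hx, hx0⟩, rfl⟩
  obtain ⟨n, hn⟩ := Set.mem_iUnion.1 hx
  refine ⟨Set.mem_iUnion.2 ⟨n, ?_⟩, by simp [mem_halfPlane_up]⟩
  exact proj_mem_bpIter (fun _ hU _ hy => snd_nonpos_of_mem_famUk hU hy) _ n x hn
    (not_lt.1 (mt (mem_halfPlane_up x).2 hx0))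
end

section
/- Let 𝒰 be an update family and let u be an unstable direction for 𝒰. Then the closure of the half-plane H_u is all of ℤ², i.e., [H_u] = ℤ². -/
open scoped Classical

theorem inner2_add (x y : Site) (u : ℝ × ℝ) : inner2 (x + y) u = inner2 x u + inner2 y u := by
  simp only [inner2, Prod.fst_add, Prod.snd_add, Int.cast_add]
  ring

/-- A finite subset of the open half-plane `H_u` is bounded away from its boundary. -/
theorem exists_pos_inner2_le_neg {u : ℝ × ℝ} (U : Finset Site)
    (hU : (U : Set Site) ⊆ halfPlane u) : ∃ δ > 0, ∀ y ∈ U, inner2 y u ≤ -δ := by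
  rcases U.eq_empty_or_nonempty with rfl | hne
  · exact ⟨1, one_pos, by simp⟩
  · obtain ⟨z, hz, hmax⟩ := U.exists_max_image (fun y => inner2 y u) hne
    exact ⟨-inner2 z u, neg_pos.mpr (hU hz), fun y hy => by simpa using hmax y hy⟩

/-- If some rule lies at depth at least `δ` in `H_u`, each step of the dynamics started from `H_u`
advances the boundary by at least `δ`. -/
theorem mem_bpIter_halfPlane {𝒰 : Finset (Finset Site)} {u : ℝ × ℝ} {U : Finset Site}
    (hU : U ∈ 𝒰) {δ : ℝ} (hδ : ∀ y ∈ U, inner2 y u ≤ -δ) (n : ℕ) {x : Site}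
    (hx : inner2 x u < n * δ) : x ∈ bpIter 𝒰 (halfPlane u) n := by
  induction n generalizing x with
  | zero => simpa [bpIter, halfPlane] using hx
  | succ n ih =>
    refine Or.inr ⟨U, hU, fun y hy => ih ?_⟩
    have hy := hδ y hy
    rw [inner2_add]
    push_cast at hx
    linarith

/-- if `u` is an unstable direction of an update family `𝒰`, then
the bootstrap closure of the half-plane `H_u` is all of `ℤ²`. -/
theorem closure_halfPlane_unstable (𝒰 : Finset (Finset Site))
    (h𝒰 : IsUpdateFamily 𝒰) (u : ℝ × ℝ) (hu : u ∈ sphere2)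
    (hun : Unstable 𝒰 u) :
    bpClosure 𝒰 (halfPlane u) = Set.univ := by
  obtain ⟨U, hU, hsub⟩ := hun
  obtain ⟨δ, hδ, hdepth⟩ := exists_pos_inner2_le_neg U hsub
  refine Set.eq_univ_of_forall fun x => Set.mem_iUnion.mpr ?_
  obtain ⟨n, hn⟩ := exists_nat_gt (inner2 x u / δ)
  exact ⟨n, mem_bpIter_halfPlane hU hdepth n ((div_lt_iff₀ hδ).mp hn)⟩
end

section
/- For every update family 𝒰, the set of stable directions of 𝒰 is a closed subset of the unit circle S¹ that is a finite union of closed arcs (possibly degenerate to single points), each of whose endpoints u is a rational direction, i.e., satisfies l_u ∩ (ℤ²∖{(0,0)}) ≠ ∅. -/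
open scoped Classical

/-- Stability of a unit vector, unfolded: every rule has a site in the closed half-plane
complementary to `halfPlane u`. -/
lemma mem_stableSet_iff {𝒰 : Finset (Finset Site)} {u : ℝ × ℝ} :
    u ∈ stableSet 𝒰 ↔ u ∈ sphere2 ∧ ∀ U ∈ 𝒰, ∃ x ∈ U, 0 ≤ inner2 x u := by
  simp [stableSet, Stable, Unstable, halfPlane, Set.subset_def]

lemma continuous_inner2 (x : Site) : Continuous (inner2 x) := by
  unfold inner2
  fun_prop

lemma cos_sin_mem_sphere2 (θ : ℝ) : (Real.cos θ, Real.sin θ) ∈ sphere2 :=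
  Real.cos_sq_add_sin_sq θ

lemma exists_angle_of_mem_sphere2 {u : ℝ × ℝ} (hu : u ∈ sphere2) :
    ∃ θ ∈ Set.Icc (-Real.pi) Real.pi, (Real.cos θ, Real.sin θ) = u := by
  have hn : ‖(⟨u.1, u.2⟩ : ℂ)‖ = 1 := by
    have h : u.1 ^ 2 + u.2 ^ 2 = 1 := hu
    rw [Complex.norm_eq_sqrt_sq_add_sq, h, Real.sqrt_one]
  have h0 : (⟨u.1, u.2⟩ : ℂ) ≠ 0 := by
    rw [← norm_ne_zero_iff, hn]
    exact one_ne_zero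
  refine ⟨Complex.arg ⟨u.1, u.2⟩, ⟨(Complex.neg_pi_lt_arg _).le, Complex.arg_le_pi _⟩, ?_⟩
  rw [Complex.cos_arg h0, Complex.sin_arg, hn]
  simp

lemma isClosed_stableSet (𝒰 : Finset (Finset Site)) : IsClosed (stableSet 𝒰) := by
  have h : stableSet 𝒰 = sphere2 ∩ ⋂ U ∈ 𝒰, ⋃ x ∈ U, {u | 0 ≤ inner2 x u} := by
    ext u
    simp [mem_stableSet_iff]
  rw [h]
  refine IsClosed.inter (isClosed_eq (by fun_prop) continuous_const) ?_
  exact isClosed_biInter fun U _ => U.finite_toSet.isClosed_biUnion fun x _ =>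
    isClosed_le continuous_const (continuous_inner2 x)

/-- Two angles perpendicular to the same nonzero vector differ by a multiple of `π`. -/
lemma sin_sub_eq_zero_of_inner2_eq_zero {x : Site} (hx : x ≠ (0, 0)) {θ φ : ℝ}
    (hθ : inner2 x (Real.cos θ, Real.sin θ) = 0)
    (hφ : inner2 x (Real.cos φ, Real.sin φ) = 0) : Real.sin (θ - φ) = 0 := by
  simp only [inner2] at hθ hφ
  rw [Real.sin_sub]
  have h1 : (x.1 : ℝ) * (Real.sin θ * Real.cos φ - Real.cos θ * Real.sin φ) = 0 := by
    linear_combination Real.sin θ * hφ - Real.sin φ * hθ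
  have h2 : (x.2 : ℝ) * (Real.sin θ * Real.cos φ - Real.cos θ * Real.sin φ) = 0 := by
    linear_combination Real.cos φ * hθ - Real.cos θ * hφ
  by_contra hne
  refine hx (Prod.ext ?_ ?_)
  · exact_mod_cast (mul_eq_zero.mp h1).resolve_right hne
  · exact_mod_cast (mul_eq_zero.mp h2).resolve_right hne

lemma finite_angles_inner2_eq_zero {x : Site} (hx : x ≠ (0, 0)) :
    {θ ∈ Set.Icc (-Real.pi) Real.pi | inner2 x (Real.cos θ, Real.sin θ) = 0}.Finite := by
  rcases Set.eq_empty_or_nonempty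
    {θ ∈ Set.Icc (-Real.pi) Real.pi | inner2 x (Real.cos θ, Real.sin θ) = 0} with h | ⟨φ, hφ, hφ0⟩
  · rw [h]
    exact Set.finite_empty
  refine ((Set.finite_Icc (-2 : ℤ) 2).image fun n : ℤ => φ + n * Real.pi).subset ?_
  rintro θ ⟨hθ, hθ0⟩
  obtain ⟨n, hn⟩ := Real.sin_eq_zero_iff.mp (sin_sub_eq_zero_of_inner2_eq_zero hx hθ0 hφ0)
  have hpi := Real.pi_pos
  refine ⟨n, ⟨?_, ?_⟩, by linarith⟩
  · have : (-2 : ℝ) ≤ n := le_of_mul_le_mul_right (by linarith [hθ.1, hφ.2]) hpi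
    exact_mod_cast this
  · have : (n : ℝ) ≤ 2 := le_of_mul_le_mul_right (by linarith [hθ.2, hφ.1]) hpi
    exact_mod_cast this

/-- A continuous function nonnegative at a point of an interval without zeros in its interior
is nonnegative on the whole interval. -/
lemma nonneg_on_Icc_of_ne_zero_on_Ioo {f : ℝ → ℝ} (hf : Continuous f) {p q θ y : ℝ}
    (hne : ∀ z ∈ Set.Ioo p q, f z ≠ 0) (hθ : θ ∈ Set.Ioo p q) (h : 0 ≤ f θ)
    (hy : y ∈ Set.Icc p q) : 0 ≤ f y := by
  have hpos : 0 < f θ := lt_of_le_of_ne h (hne θ hθ).symm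
  by_contra! hlt
  rcases le_total y θ with hle | hle
  · obtain ⟨z, hz, hz0⟩ := intermediate_value_Ioo hle hf.continuousOn ⟨hlt, hpos⟩
    exact hne z ⟨hy.1.trans_lt hz.1, hz.2.trans hθ.2⟩ hz0
  · obtain ⟨z, hz, hz0⟩ := intermediate_value_Ioo' hle hf.continuousOn ⟨hlt, hpos⟩
    exact hne z ⟨hθ.1.trans hz.1, hz.2.trans_le hy.2⟩ hz0

/-- A point of `[a, b]` outside a finite set containing `a` and `b` lies in a gap of that set. -/
lemma exists_gap_of_notMem {T : Finset ℝ} {a b θ : ℝ} (ha : a ∈ T) (hb : b ∈ T)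
    (hθ : θ ∈ Set.Icc a b) (hT : θ ∉ T) :
    ∃ p ∈ T, ∃ q ∈ T, θ ∈ Set.Ioo p q ∧ ∀ z ∈ Set.Ioo p q, z ∉ T := by
  have lt_of_mem_le {t : ℝ} (ht : t ∈ T) (h : t ≤ θ) : t < θ :=
    lt_of_le_of_ne h fun e => hT (e ▸ ht)
  have lt_of_le_mem {t : ℝ} (ht : t ∈ T) (h : θ ≤ t) : θ < t :=
    lt_of_le_of_ne h fun e => hT (e ▸ ht)
  obtain ⟨p, hp, hpmax⟩ := (T.filter (· ≤ θ)).exists_max_image id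
    ⟨a, Finset.mem_filter.mpr ⟨ha, hθ.1⟩⟩
  obtain ⟨q, hq, hqmin⟩ := (T.filter (θ ≤ ·)).exists_min_image id
    ⟨b, Finset.mem_filter.mpr ⟨hb, hθ.2⟩⟩
  rw [Finset.mem_filter] at hp hq
  refine ⟨p, hp.1, q, hq.1, ⟨lt_of_mem_le hp.1 hp.2, lt_of_le_mem hq.1 hq.2⟩, ?_⟩
  intro z hz hzT
  rcases le_total z θ with h | h
  · exact (hpmax z (Finset.mem_filter.mpr ⟨hzT, h⟩)).not_gt hz.1
  · exact (hqmin z (Finset.mem_filter.mpr ⟨hzT, h⟩)).not_gt hz.2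

/-- the set of stable directions is a closed subset of the unit
circle, equal to a finite union of closed arcs (each parametrised as the image
of a closed angle interval of length at most `2π`, possibly degenerate), and
each endpoint of each arc is a rational direction, i.e. is perpendicular to a
nonzero lattice vector. -/
theorem stableSet_closed_finite_union_arcs (𝒰 : Finset (Finset Site))
    (h𝒰 : IsUpdateFamily 𝒰) :
    IsClosed (stableSet 𝒰) ∧ stableSet 𝒰 ⊆ sphere2 ∧
      ∃ I : Finset (ℝ × ℝ),
        (∀ p ∈ I, p.1 ≤ p.2 ∧ p.2 ≤ p.1 + 2 * Real.pi ∧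
          (∃ x : Site, x ≠ (0, 0) ∧ inner2 x (Real.cos p.1, Real.sin p.1) = 0) ∧
          (∃ x : Site, x ≠ (0, 0) ∧ inner2 x (Real.cos p.2, Real.sin p.2) = 0)) ∧
        stableSet 𝒰 = ⋃ p ∈ I, (fun θ : ℝ => (Real.cos θ, Real.sin θ)) '' Set.Icc p.1 p.2 := by
  refine ⟨isClosed_stableSet 𝒰, fun u hu => hu.1, ?_⟩
  set X : Finset Site := insert (0, 1) (𝒰.biUnion id)
  have hX0 : ∀ x ∈ X, x ≠ (0, 0) := by
    intro x hx
    rcases Finset.mem_insert.mp hx with rfl | hx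
    · simp
    · obtain ⟨U, hU, hxU⟩ := Finset.mem_biUnion.mp hx
      rintro rfl
      exact (h𝒰.2 U hU).2 hxU
  have hfin : (⋃ x ∈ X, {θ ∈ Set.Icc (-Real.pi) Real.pi |
      inner2 x (Real.cos θ, Real.sin θ) = 0}).Finite :=
    X.finite_toSet.biUnion fun x hx => finite_angles_inner2_eq_zero (hX0 x hx)
  set T : Finset ℝ := hfin.toFinset
  have hT : ∀ θ, θ ∈ T ↔ θ ∈ Set.Icc (-Real.pi) Real.pi ∧
      ∃ x ∈ X, inner2 x (Real.cos θ, Real.sin θ) = 0 := by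
    intro θ
    simp only [T, Set.Finite.mem_toFinset, Set.mem_iUnion, Set.mem_ofPred_eq, exists_prop]
    tauto
  have hpi := Real.pi_pos
  have hneg_pi : -Real.pi ∈ T :=
    (hT _).mpr ⟨⟨le_rfl, by linarith⟩, (0, 1), Finset.mem_insert_self _ _, by simp [inner2]⟩
  have hpos_pi : Real.pi ∈ T :=
    (hT _).mpr ⟨⟨by linarith, le_rfl⟩, (0, 1), Finset.mem_insert_self _ _, by simp [inner2]⟩
  refine ⟨(T ×ˢ T).filter fun p => p.1 ≤ p.2 ∧
    ∀ θ ∈ Set.Icc p.1 p.2, (Real.cos θ, Real.sin θ) ∈ stableSet 𝒰, ?_, ?_⟩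
  · intro p hp
    simp only [Finset.mem_filter, Finset.mem_product, hT] at hp
    obtain ⟨⟨⟨h1, x, hx, hx0⟩, h2, y, hy, hy0⟩, hle, -⟩ := hp
    exact ⟨hle, by linarith [h1.1, h2.2], ⟨x, hX0 x hx, hx0⟩, ⟨y, hX0 y hy, hy0⟩⟩
  · ext u
    simp only [Set.mem_iUnion, exists_prop, Finset.mem_filter, Finset.mem_product]
    constructor
    · intro hu
      obtain ⟨θ, hθ, rfl⟩ := exists_angle_of_mem_sphere2 hu.1
      by_cases hθT : θ ∈ T
      · refine ⟨(θ, θ), ⟨⟨hθT, hθT⟩, le_rfl, fun φ hφ => ?_⟩, θ, ⟨le_rfl, le_rfl⟩, rfl⟩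
        rwa [le_antisymm hφ.2 hφ.1]
      · obtain ⟨p, hp, q, hq, hpq, hgap⟩ := exists_gap_of_notMem hneg_pi hpos_pi hθ hθT
        refine ⟨(p, q), ⟨⟨hp, hq⟩, (hpq.1.trans hpq.2).le, fun φ hφ => ?_⟩,
          θ, ⟨hpq.1.le, hpq.2.le⟩, rfl⟩
        refine mem_stableSet_iff.mpr ⟨cos_sin_mem_sphere2 φ, fun U hU => ?_⟩
        obtain ⟨x, hxU, hx⟩ := (mem_stableSet_iff.mp hu).2 U hU
        have hxX : x ∈ X := Finset.mem_insert_of_mem (Finset.mem_biUnion.mpr ⟨U, hU, hxU⟩)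
        refine ⟨x, hxU, nonneg_on_Icc_of_ne_zero_on_Ioo
          (f := fun t => inner2 x (Real.cos t, Real.sin t))
          ((continuous_inner2 x).comp (by fun_prop)) (fun z hz hz0 => hgap z hz ?_) hpq hx hφ⟩
        exact (hT z).mpr ⟨⟨((hT p).mp hp).1.1.trans hz.1.le, hz.2.le.trans ((hT q).mp hq).1.2⟩,
          x, hxX, hz0⟩
    · rintro ⟨p, ⟨-, -, hp⟩, θ, hθ, rfl⟩
      exact hp θ hθ
end
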